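/- arXiv:2506.03549 — 2 statements merged into one kernel-verified Lean document; each statement's English description precedes it below -/
import Mathlib

section
/- Fix natural numbers n, k ≥ 1, a function g : (Fin k → Bool) × (Fin k → Bool) × (Fin k → Bool) → Bool, and a real ν with 0 ≤ ν ≤ 1/2. Let N = 2^(2n). Then the number of functions f : (Fin n → Bool) × (Fin n → Bool) → Bool for which there exist f_A, f_B : (Fin n → Bool) → (Fin k → Bool) and λ : Fin k → Bool such that the number of pairs (x, y) with f(x, y) ≠ g(f_A(x), f_B(y), λ) is at most ν·N, is at most 2^(k·(2^(n+1)+1)) · 2^(N·h₂(ν)), where h₂ is the binary entropy in bits. -/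
open Finset

/-- **Entropy bound on Hamming balls**: a set of `N` elements has at most `exp (N * H(ν))` subsets
of size at most `ν * N`, where `0 ≤ ν ≤ 1/2` and `H` is the binary entropy in nats. -/
theorem card_finset_card_le_exp_binEntropy (α : Type*) [Fintype α] {ν : ℝ}
    (hν0 : 0 ≤ ν) (hν1 : ν ≤ 1 / 2) :
    (Nat.card {s : Finset α // (#s : ℝ) ≤ ν * Fintype.card α} : ℝ) ≤
      Real.exp (Fintype.card α * Real.binEntropy ν) := by
  classical
  obtain rfl | hpos := hν0.eq_or_lt
  · have : Subsingleton {s : Finset α // (#s : ℝ) ≤ 0 * Fintype.card α} := by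
      refine ⟨fun s t ↦ Subtype.ext ?_⟩
      have hs := s.2
      have ht := t.2
      simp only [zero_mul, Nat.cast_nonpos, card_eq_zero] at hs ht
      rw [hs, ht]
    simp
  have hpos' : 0 < 1 - ν := by linarith
  rw [Nat.card_eq_fintype_card, Fintype.card_subtype]
  set N := Fintype.card α with hN
  set B : Finset (Finset α) := {s | (#s : ℝ) ≤ ν * N} with hB
  have hterm : ∀ s ∈ B, Real.exp (-(N * Real.binEntropy ν)) ≤ ν ^ #s * (1 - ν) ^ (N - #s) := by
    intro s hs
    have hsB : (#s : ℝ) ≤ ν * N := by simpa [hB] using hs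
    have hlog : Real.log ν ≤ Real.log (1 - ν) := Real.log_le_log hpos (by linarith)
    rw [← Real.le_log_iff_exp_le (by positivity), Real.log_mul (by positivity) (by positivity),
      Real.log_pow, Real.log_pow, Nat.cast_sub (card_le_univ s), Real.binEntropy,
      Real.log_inv, Real.log_inv]
    nlinarith [mul_nonneg (sub_nonneg.2 hsB) (sub_nonneg.2 hlog)]
  have hsum : #B * Real.exp (-(N * Real.binEntropy ν)) ≤ 1 :=
    calc #B * Real.exp (-(N * Real.binEntropy ν))
        = ∑ _s ∈ B, Real.exp (-(N * Real.binEntropy ν)) := by simp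
      _ ≤ ∑ s ∈ B, ν ^ #s * (1 - ν) ^ (N - #s) := sum_le_sum hterm
      _ ≤ ∑ s : Finset α, ν ^ #s * (1 - ν) ^ (N - #s) :=
          sum_le_sum_of_subset_of_nonneg (subset_univ _) fun _ _ _ ↦ by positivity
      _ = 1 := by rw [Fintype.sum_pow_mul_eq_add_pow]; simp
  rwa [Real.exp_neg, ← div_eq_mul_inv, div_le_one (Real.exp_pos _)] at hsum

/-- The number of Boolean functions at distance at most `r` from a family indexed by `T` is at most
`|T|` times the size of a Hamming ball of radius `r`. -/
theorem card_exists_hamming_le {α T : Type*} [Fintype α] [Finite T] (G : T → α → Bool) (r : ℝ) :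
    Nat.card {f : α → Bool // ∃ t, (#{p | f p ≠ G t p} : ℝ) ≤ r} ≤
      Nat.card T * Nat.card {s : Finset α // (#s : ℝ) ≤ r} := by
  classical
  rw [← Nat.card_prod]
  let φ : {f : α → Bool // ∃ t, (#{p | f p ≠ G t p} : ℝ) ≤ r} →
      T × {s : Finset α // (#s : ℝ) ≤ r} :=
    fun f ↦ (f.2.choose, ⟨({p | f.1 p ≠ G f.2.choose p} : Finset α), f.2.choose_spec⟩)
  refine Nat.card_le_card_of_injective φ fun f f' h ↦ ?_
  have h1 : f.2.choose = f'.2.choose := congrArg Prod.fst h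
  have h2 : ({p | f.1 p ≠ G f.2.choose p} : Finset α) =
      ({p | f'.1 p ≠ G f'.2.choose p} : Finset α) :=
    congrArg (fun x ↦ x.2.1) h
  refine Subtype.ext (funext fun p ↦ ?_)
  have h3 := Finset.ext_iff.1 h2 p
  rw [← h1] at h3
  simp only [mem_filter_univ, ne_eq, not_iff_not] at h3
  revert h3
  cases f.1 p <;> cases f'.1 p <;> cases G f.2.choose p <;> simp

/-- **Counting functions close in Hamming distance to an implementable function**:
for a fixed rounding function `g`, a real `0 ≤ ν ≤ 1/2` and `N = 2^(2n)`, the number of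
functions `f : {0,1}^n × {0,1}^n → {0,1}` for which some `f_A, f_B, λ` make
`g(f_A(x), f_B(y), λ)` differ from `f(x,y)` on at most `ν·N` pairs `(x,y)` is at most
`2^(k·(2^(n+1)+1)) · 2^(N·h₂(ν))`, with `h₂` the binary entropy in bits. -/
theorem hamming_ball_implementable_card_le (n k : ℕ) (hn : 1 ≤ n) (hk : 1 ≤ k)
    (g : (Fin k → Bool) × (Fin k → Bool) × (Fin k → Bool) → Bool)
    (ν : ℝ) (hν0 : 0 ≤ ν) (hν1 : ν ≤ 1 / 2) :
    (Nat.card {f : (Fin n → Bool) × (Fin n → Bool) → Bool //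
        ∃ fA fB : (Fin n → Bool) → (Fin k → Bool), ∃ lam : Fin k → Bool,
          ((Finset.univ.filter
              (fun p : (Fin n → Bool) × (Fin n → Bool) =>
                f p ≠ g (fA p.1, fB p.2, lam))).card : ℝ) ≤ ν * 2 ^ (2 * n)} : ℝ) ≤
      2 ^ (k * (2 ^ (n + 1) + 1)) *
        (2 : ℝ) ^ ((2 ^ (2 * n) : ℝ) * (Real.binEntropy ν / Real.log 2)) := by
  let C := Fin k → Bool
  let X := Fin n → Bool
  let T := (X → C) × (X → C) × C
  let G : T → X × X → Bool := fun t p ↦ g (t.1 p.1, t.2.1 p.2, t.2.2)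
  have hX : (Fintype.card (X × X) : ℝ) = 2 ^ (2 * n) := by
    simp [X, two_mul, pow_add]
  have hT : Nat.card T = 2 ^ (k * (2 ^ (n + 1) + 1)) := by
    simp only [T, C, X, Nat.card_eq_fintype_card, Fintype.card_prod, Fintype.card_fun,
      Fintype.card_bool, Fintype.card_fin]
    ring
  have hball := card_finset_card_le_exp_binEntropy (X × X) hν0 hν1
  have hcount := card_exists_hamming_le G (ν * 2 ^ (2 * n))
  simp only [T, G, Prod.exists] at hcount
  rw [hX] at hball
  rw [hT] at hcount
  have hexp : (2 : ℝ) ^ ((2 ^ (2 * n) : ℝ) * (Real.binEntropy ν / Real.log 2)) =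
      Real.exp (2 ^ (2 * n) * Real.binEntropy ν) := by
    rw [Real.rpow_def_of_pos two_pos]
    congr 1
    field_simp
  rw [hexp]
  calc _ ≤ ((2 ^ (k * (2 ^ (n + 1) + 1)) *
        Nat.card {s : Finset (X × X) // (#s : ℝ) ≤ ν * 2 ^ (2 * n)} : ℕ) : ℝ) := by
        exact_mod_cast hcount
    _ ≤ _ := by
        push_cast
        gcongr
end

section
/- Fix natural numbers n, k ≥ 1, a function g : (Fin k → Bool) × (Fin k → Bool) × (Fin k → Bool) → Bool, a real α ≥ 0, and a real ν with 0 ≤ ν ≤ 1/2 satisfying h₂(ν) ≤ 1 − k·(2^(n+1)+1)/2^(2n) − α/2^(2n), where h₂ is the binary entropy in bits. Let N = 2^(2n). Then the number of functions f : (Fin n → Bool) × (Fin n → Bool) → Bool for which there exist f_A, f_B : (Fin n → Bool) → (Fin k → Bool) and λ : Fin k → Bool with g(f_A(x), f_B(y), λ) = f(x, y) holding for at least N·(1 − ν) pairs (x, y) is at most 2^(N − α). In particular, a uniformly random such f fails this agreement property, for every choice of f_A, f_B, λ simultaneously, with probability at least 1 − 2^(−α). -/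
/-- The weights of a product Bernoulli distribution sum to one. -/
theorem sum_prod_ite_eq_one {ι : Type*} [Fintype ι] [DecidableEq ι] (h : ι → Bool) (ν : ℝ) :
    ∑ f : ι → Bool, ∏ i, (if h i = f i then 1 - ν else ν) = 1 := by
  have key := Finset.prod_univ_sum (fun _ : ι => (Finset.univ : Finset Bool))
    (fun i b => if h i = b then 1 - ν else ν)
  rw [Fintype.piFinset_univ] at key
  rw [← key]
  refine Finset.prod_eq_one fun i _ => ?_
  cases h i <;> simp

/-- A word within relative distance `ν` of `h` has weight at least `exp (-N h(ν))`. -/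
theorem exp_neg_binEntropy_le_prod_ite {ι : Type*} [Fintype ι] (h f : ι → Bool) {ν : ℝ}
    (hν0 : 0 ≤ ν) (hν1 : ν ≤ 1 / 2)
    (hf : (Fintype.card ι : ℝ) * (1 - ν) ≤
      ((Finset.univ.filter fun i => h i = f i).card : ℝ)) :
    Real.exp (-(Fintype.card ι * Real.binEntropy ν)) ≤
      ∏ i, (if h i = f i then 1 - ν else ν) := by
  rw [Finset.prod_ite, Finset.prod_const, Finset.prod_const]
  have hcard := Finset.card_filter_add_card_filter_not (s := (Finset.univ : Finset ι))
    (fun i => h i = f i)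
  rw [Finset.card_univ] at hcard
  set a := (Finset.univ.filter fun i => h i = f i).card
  set d := (Finset.univ.filter fun i => ¬ h i = f i).card
  have hN : (Fintype.card ι : ℝ) = a + d := by exact_mod_cast hcard.symm
  rw [hN] at hf ⊢
  rcases hν0.eq_or_lt with rfl | hpos
  · have hd : d = 0 := by
      have : (d : ℝ) ≤ 0 := by linarith
      exact_mod_cast le_antisymm this (Nat.cast_nonneg d)
    simp [hd]
  · have h1 : 0 < 1 - ν := by linarith
    have hlog : Real.log ν ≤ Real.log (1 - ν) := Real.log_le_log hpos (by linarith)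
    rw [← Real.exp_log (pow_pos h1 a), ← Real.exp_log (pow_pos hpos d), ← Real.exp_add,
      Real.exp_le_exp, Real.log_pow, Real.log_pow, Real.binEntropy_eq_negMulLog_add_negMulLog_one_sub]
    simp only [Real.negMulLog]
    nlinarith [mul_nonneg (sub_nonneg.2 hf) (sub_nonneg.2 hlog)]

/-- The Hamming ball of relative radius `ν ≤ 1/2` has at most `exp (N h(ν))` elements. -/
theorem card_hammingBall_le_exp_binEntropy {ι : Type*} [Fintype ι] [DecidableEq ι]
    (h : ι → Bool) {ν : ℝ} (hν0 : 0 ≤ ν) (hν1 : ν ≤ 1 / 2) (s : Finset (ι → Bool))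
    (hs : ∀ f ∈ s, (Fintype.card ι : ℝ) * (1 - ν) ≤
      ((Finset.univ.filter fun i => h i = f i).card : ℝ)) :
    (s.card : ℝ) ≤ Real.exp (Fintype.card ι * Real.binEntropy ν) := by
  have hle : (s.card : ℝ) * Real.exp (-(Fintype.card ι * Real.binEntropy ν)) ≤ 1 := by
    rw [← nsmul_eq_mul, ← sum_prod_ite_eq_one h ν]
    refine (Finset.card_nsmul_le_sum s _ _ fun f hf =>
      exp_neg_binEntropy_le_prod_ite h f hν0 hν1 (hs f hf)).trans ?_
    refine Finset.sum_le_sum_of_subset_of_nonneg (Finset.subset_univ s) fun f _ _ =>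
      Finset.prod_nonneg fun i _ => ?_
    split_ifs <;> linarith
  rwa [Real.exp_neg, ← div_eq_mul_inv, div_le_one (Real.exp_pos _)] at hle

/-- Union bound: the words within relative distance `ν` of a family indexed by `T`. -/
theorem card_near_family_le {ι T : Type*} [Fintype ι] [DecidableEq ι] [Fintype T]
    (F : T → ι → Bool) {ν : ℝ} (hν0 : 0 ≤ ν) (hν1 : ν ≤ 1 / 2) :
    (Nat.card {f : ι → Bool // ∃ t, (Fintype.card ι : ℝ) * (1 - ν) ≤
        ((Finset.univ.filter fun i => F t i = f i).card : ℝ)} : ℝ) ≤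
      Fintype.card T * Real.exp (Fintype.card ι * Real.binEntropy ν) := by
  classical
  rw [Nat.card_eq_fintype_card, Fintype.card_subtype]
  let B : T → Finset (ι → Bool) := fun t => Finset.univ.filter fun f =>
    (Fintype.card ι : ℝ) * (1 - ν) ≤ ((Finset.univ.filter fun i => F t i = f i).card : ℝ)
  have hB : ∀ t, ((B t).card : ℝ) ≤ Real.exp (Fintype.card ι * Real.binEntropy ν) := fun t =>
    card_hammingBall_le_exp_binEntropy (F t) hν0 hν1 (B t) fun f hf => (Finset.mem_filter.1 hf).2
  have hsub : (Finset.univ.filter fun f : ι → Bool => ∃ t, (Fintype.card ι : ℝ) * (1 - ν) ≤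
      ((Finset.univ.filter fun i => F t i = f i).card : ℝ)) ⊆ Finset.univ.biUnion B := by
    intro f hf
    simpa [B] using hf
  have hunion := (Finset.card_le_card hsub).trans Finset.card_biUnion_le
  rw [← Nat.cast_le (α := ℝ), Nat.cast_sum] at hunion
  calc _ ≤ ∑ t, ((B t).card : ℝ) := hunion
    _ ≤ ∑ _t : T, Real.exp (Fintype.card ι * Real.binEntropy ν) :=
      Finset.sum_le_sum fun t _ => hB t
    _ = _ := by rw [Finset.sum_const, Finset.card_univ, nsmul_eq_mul]

/-- **A random function is far from all implementable functions**: fix a rounding function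
`g`, `α ≥ 0` and `0 ≤ ν ≤ 1/2` with `h₂(ν) ≤ 1 − k(2^(n+1)+1)/2^(2n) − α/2^(2n)`.
With `N = 2^(2n)`, the number of `f : {0,1}^n × {0,1}^n → {0,1}` admitting `f_A, f_B, λ`
such that `g(f_A(x), f_B(y), λ) = f(x,y)` for at least `N(1−ν)` pairs `(x,y)` is at most
`2^(N−α)`; in particular a uniformly random `f` fails this agreement property (for all
`f_A, f_B, λ` simultaneously) with probability at least `1 − 2^(−α)`. -/
theorem random_function_agreement_bound (n k : ℕ) (hn : 1 ≤ n) (hk : 1 ≤ k)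
    (g : (Fin k → Bool) × (Fin k → Bool) × (Fin k → Bool) → Bool)
    (α : ℝ) (hα : 0 ≤ α) (ν : ℝ) (hν0 : 0 ≤ ν) (hν1 : ν ≤ 1 / 2)
    (hent : Real.binEntropy ν / Real.log 2 ≤
      1 - (k * (2 ^ (n + 1) + 1) : ℝ) / 2 ^ (2 * n) - α / 2 ^ (2 * n)) :
    (Nat.card {f : (Fin n → Bool) × (Fin n → Bool) → Bool //
        ∃ fA fB : (Fin n → Bool) → (Fin k → Bool), ∃ lam : Fin k → Bool,
          ((2 ^ (2 * n) : ℝ) * (1 - ν)) ≤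
            ((Finset.univ.filter
                (fun p : (Fin n → Bool) × (Fin n → Bool) =>
                  g (fA p.1, fB p.2, lam) = f p)).card : ℝ)} : ℝ) ≤
      (2 : ℝ) ^ ((2 ^ (2 * n) : ℝ) - α) ∧
    ((2 : ℝ) ^ (2 ^ (2 * n)) * (1 - (2 : ℝ) ^ (-α)) ≤
      (Nat.card {f : (Fin n → Bool) × (Fin n → Bool) → Bool //
        ¬ ∃ fA fB : (Fin n → Bool) → (Fin k → Bool), ∃ lam : Fin k → Bool,
          ((2 ^ (2 * n) : ℝ) * (1 - ν)) ≤
            ((Finset.univ.filter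
                (fun p : (Fin n → Bool) × (Fin n → Bool) =>
                  g (fA p.1, fB p.2, lam) = f p)).card : ℝ)} : ℝ)) := by
  have hcard : Fintype.card ((Fin n → Bool) × (Fin n → Bool)) = 2 ^ (2 * n) := by
    simp [two_mul, pow_add]
  have hlog : 0 < Real.log 2 := Real.log_pos one_lt_two
  have hbound := card_near_family_le
    (fun (t : ((Fin n → Bool) → (Fin k → Bool)) × ((Fin n → Bool) → (Fin k → Bool)) ×
      (Fin k → Bool)) (p : (Fin n → Bool) × (Fin n → Bool)) =>
        g (t.1 p.1, t.2.1 p.2, t.2.2)) hν0 hν1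
  have hT : Fintype.card (((Fin n → Bool) → (Fin k → Bool)) ×
      ((Fin n → Bool) → (Fin k → Bool)) × (Fin k → Bool)) = 2 ^ (k * (2 ^ (n + 1) + 1)) := by
    simp only [Fintype.card_prod, Fintype.card_fun, Fintype.card_bool, Fintype.card_fin]
    ring
  simp only [hcard, hT, Prod.exists, Nat.cast_pow, Nat.cast_ofNat] at hbound
  have hexp : (2 : ℝ) ^ (k * (2 ^ (n + 1) + 1)) *
      Real.exp (2 ^ (2 * n) * Real.binEntropy ν) ≤ (2 : ℝ) ^ ((2 ^ (2 * n) : ℝ) - α) := by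
    have hN : (0 : ℝ) < 2 ^ (2 * n) := by positivity
    have hent' : 2 ^ (2 * n) * Real.binEntropy ν ≤
        Real.log 2 * (2 ^ (2 * n) - k * (2 ^ (n + 1) + 1) - α) := by
      rw [div_le_iff₀ hlog] at hent
      refine (mul_le_mul_of_nonneg_left hent hN.le).trans_eq ?_
      field_simp
    rw [← Real.rpow_natCast, Real.rpow_def_of_pos two_pos, Real.rpow_def_of_pos two_pos,
      ← Real.exp_add, Real.exp_le_exp]
    push_cast
    linarith
  have hmain := hbound.trans hexp
  refine ⟨hmain, ?_⟩
  classical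
  rw [Nat.card_eq_fintype_card] at hmain ⊢
  rw [Fintype.card_subtype_compl, Nat.cast_sub (Fintype.card_subtype_le _), Fintype.card_fun,
    hcard, Fintype.card_bool]
  have hsplit : (2 : ℝ) ^ ((2 ^ (2 * n) : ℝ) - α) = 2 ^ (2 ^ (2 * n)) * (2 : ℝ) ^ (-α) := by
    rw [sub_eq_add_neg, Real.rpow_add two_pos,
      show ((2 : ℝ) ^ (2 * n)) = ((2 ^ (2 * n) : ℕ) : ℝ) by push_cast; rfl, Real.rpow_natCast]
  rw [hsplit] at hmain
  push_cast
  linarith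
end
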